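/- There exists an absolute constant c > 0 (chosen small enough) with the following property. Let 0 ≤ ε ≤ 1 and assume μ ≤ cε/(‖X‖κ), ‖Z_t‖ ≤ 2√‖X‖, ‖Δ_t‖ ≤ cεσ_min(X), ‖L_{X,⊥}ᵀP_{Z_tQ_t}‖ ≤ cε/κ, and that L_XᵀZ_{t+1}Q_t and L_XᵀZ_tQ_t have full rank. Then ‖Z_{t+1}Q_{t+1,⊥}‖ ≤ (1 − (μ/2)‖Z_tQ_{t,⊥}‖² + μεσ_min(X)) · ‖Z_tQ_{t,⊥}‖ + 2μ√‖X‖ · ‖Z̃_tᵀZ_tQ_{t,⊥}‖. -/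

import Mathlib

open Matrix MeasureTheory ProbabilityTheory

noncomputable section

namespace AsymMatrixSensing

/-- Euclidean norm of a real vector. -/
def euclNorm {ι : Type*} [Fintype ι] (v : ι → ℝ) : ℝ :=
  Real.sqrt (∑ i, v i ^ 2)

/-- Spectral norm of a real matrix. -/
def specNorm {ι₁ ι₂ : Type*} [Fintype ι₁] [Fintype ι₂] (M : Matrix ι₁ ι₂ ℝ) : ℝ :=
  sSup {c : ℝ | ∃ x : ι₂ → ℝ, euclNorm x ≤ 1 ∧ c = euclNorm (M.mulVec x)}

/-- Frobenius norm of a real matrix. -/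
def frobNorm {ι₁ ι₂ : Type*} [Fintype ι₁] [Fintype ι₂] (M : Matrix ι₁ ι₂ ℝ) : ℝ :=
  Real.sqrt (∑ i, ∑ j, M i j ^ 2)

/-- Nuclear norm of a real matrix (characterized by duality with the spectral norm). -/
def nucNorm {ι₁ ι₂ : Type*} [Fintype ι₁] [Fintype ι₂] (M : Matrix ι₁ ι₂ ℝ) : ℝ :=
  sSup {c : ℝ | ∃ B : Matrix ι₁ ι₂ ℝ, specNorm B ≤ 1 ∧ c = ∑ i, ∑ j, M i j * B i j}

/-- Smallest singular value `σ_{min(a,b)}(M)` of a matrix. -/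
def sigmaMin {ι₁ ι₂ : Type*} [Fintype ι₁] [Fintype ι₂] (M : Matrix ι₁ ι₂ ℝ) : ℝ :=
  max (sInf {c : ℝ | ∃ x : ι₂ → ℝ, euclNorm x = 1 ∧ c = euclNorm (M.mulVec x)})
      (sInf {c : ℝ | ∃ y : ι₁ → ℝ, euclNorm y = 1 ∧ c = euclNorm (Mᵀ.mulVec y)})

/-- Smallest nonzero singular value `σ_rank(M)`: the minimum of `‖Mx‖` over unit
vectors `x` orthogonal to the kernel of `M`. -/
def sigmaPos {ι₁ ι₂ : Type*} [Fintype ι₁] [Fintype ι₂] (M : Matrix ι₁ ι₂ ℝ) : ℝ :=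
  sInf {c : ℝ | ∃ x : ι₂ → ℝ, euclNorm x = 1 ∧
    (∀ y : ι₂ → ℝ, M.mulVec y = 0 → x ⬝ᵥ y = 0) ∧ c = euclNorm (M.mulVec x)}

/-- Condition number `κ = ‖M‖ / σ_min(M)`. -/
def condNum {ι₁ ι₂ : Type*} [Fintype ι₁] [Fintype ι₂] (M : Matrix ι₁ ι₂ ℝ) : ℝ :=
  specNorm M / sigmaPos M

/-- Trace inner product `⟨M, N⟩ = trace(Mᵀ N)`. -/
def minner {ι₁ ι₂ : Type*} [Fintype ι₁] [Fintype ι₂] (M N : Matrix ι₁ ι₂ ℝ) : ℝ :=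
  ∑ i, ∑ j, M i j * N i j

/-- `P` is a matrix with orthonormal columns spanning the column space of `M`. -/
def IsOrthCol {ι κ₁ κ₂ : Type*} [Fintype ι] [Fintype κ₁] [Fintype κ₂] [DecidableEq κ₂]
    (P : Matrix ι κ₂ ℝ) (M : Matrix ι κ₁ ℝ) : Prop :=
  Pᵀ * P = 1 ∧ (∃ C : Matrix κ₁ κ₂ ℝ, P = M * C) ∧ P * Pᵀ * M = M

/-- `L` has orthonormal columns spanning the subspace spanned by eigenvectors of the
symmetric matrix `F` corresponding to its `r` largest eigenvalues. -/
def IsTopEigenspace {ι : Type*} [Fintype ι] [DecidableEq ι] {r : ℕ} (F : Matrix ι ι ℝ)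
    (L : Matrix ι (Fin r) ℝ) : Prop :=
  Lᵀ * L = 1 ∧ ∃ d : Fin r → ℝ, F * L = L * Matrix.diagonal d ∧
    ∀ (v : ι → ℝ) (lam : ℝ), v ≠ 0 → F.mulVec v = lam • v →
      Lᵀ.mulVec v = 0 → ∀ i, lam ≤ d i

variable {n₁ n₂ m k r : ℕ}

/-- The measurement operator `𝒜`, given by `[𝒜(Z)]ᵢ = ⟨Aᵢ, Z⟩`. -/
def calA (A : Fin m → Matrix (Fin n₁) (Fin n₂) ℝ) (Z : Matrix (Fin n₁) (Fin n₂) ℝ) :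
    Fin m → ℝ := fun i => minner (A i) Z

/-- The restricted isometry property of order `s` with constant `δ`. -/
def HasRIP (A : Fin m → Matrix (Fin n₁) (Fin n₂) ℝ) (s : ℕ) (δ : ℝ) : Prop :=
  ∀ M : Matrix (Fin n₁) (Fin n₂) ℝ, M.rank ≤ s →
    (1 - δ) * frobNorm M ^ 2 ≤ ∑ i, calA A M i ^ 2 ∧
      ∑ i, calA A M i ^ 2 ≤ (1 + δ) * frobNorm M ^ 2

/-- `𝒜*𝒜`. -/
def AstarA (A : Fin m → Matrix (Fin n₁) (Fin n₂) ℝ) (Z : Matrix (Fin n₁) (Fin n₂) ℝ) :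
    Matrix (Fin n₁) (Fin n₂) ℝ := ∑ i, minner (A i) Z • A i

/-- The symmetrization `sym(X) = [[0, X], [Xᵀ, 0]]`. -/
def symMat (X : Matrix (Fin n₁) (Fin n₂) ℝ) :
    Matrix (Fin n₁ ⊕ Fin n₂) (Fin n₁ ⊕ Fin n₂) ℝ := Matrix.fromBlocks 0 X Xᵀ 0

/-- The symmetrized measurement matrices `Bᵢ = (1/√2)[[0, Aᵢ], [Aᵢᵀ, 0]]`. -/
def Bmat (A : Fin m → Matrix (Fin n₁) (Fin n₂) ℝ) (i : Fin m) :
    Matrix (Fin n₁ ⊕ Fin n₂) (Fin n₁ ⊕ Fin n₂) ℝ :=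
  (Real.sqrt 2)⁻¹ • Matrix.fromBlocks 0 (A i) (A i)ᵀ 0

/-- `ℬ*ℬ`. -/
def BstarB (A : Fin m → Matrix (Fin n₁) (Fin n₂) ℝ)
    (S : Matrix (Fin n₁ ⊕ Fin n₂) (Fin n₁ ⊕ Fin n₂) ℝ) :
    Matrix (Fin n₁ ⊕ Fin n₂) (Fin n₁ ⊕ Fin n₂) ℝ :=
  ∑ i, minner (Bmat A i) S • Bmat A i

/-- The factorized gradient descent iterates `(V_t, W_t)`. -/
def iter (A : Fin m → Matrix (Fin n₁) (Fin n₂) ℝ) (X : Matrix (Fin n₁) (Fin n₂) ℝ)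
    (μ : ℝ) (V₀ : Matrix (Fin n₁) (Fin k) ℝ) (W₀ : Matrix (Fin n₂) (Fin k) ℝ) :
    ℕ → Matrix (Fin n₁) (Fin k) ℝ × Matrix (Fin n₂) (Fin k) ℝ
  | 0 => (V₀, W₀)
  | t + 1 =>
    let p := iter A X μ V₀ W₀ t
    let G := AstarA A (p.1 * p.2ᵀ - X)
    (p.1 - μ • (G * p.2), p.2 - μ • (Gᵀ * p.1))

/-- The vertical stacking `(1/√2)[V; W]`. -/
def Zstack {κ : ℕ} (V : Matrix (Fin n₁) (Fin κ) ℝ) (W : Matrix (Fin n₂) (Fin κ) ℝ) :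
    Matrix (Fin n₁ ⊕ Fin n₂) (Fin κ) ℝ :=
  (Real.sqrt 2)⁻¹ • Matrix.fromRows V W

/-- `Z_t = (1/√2)[V_t; W_t]`. -/
def Zit (A : Fin m → Matrix (Fin n₁) (Fin n₂) ℝ) (X : Matrix (Fin n₁) (Fin n₂) ℝ)
    (μ : ℝ) (V₀ : Matrix (Fin n₁) (Fin k) ℝ) (W₀ : Matrix (Fin n₂) (Fin k) ℝ) (t : ℕ) :
    Matrix (Fin n₁ ⊕ Fin n₂) (Fin k) ℝ :=
  Zstack (iter A X μ V₀ W₀ t).1 (iter A X μ V₀ W₀ t).2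

/-- `Z̃_t = (1/√2)[V_t; −W_t]`. -/
def Ztil (A : Fin m → Matrix (Fin n₁) (Fin n₂) ℝ) (X : Matrix (Fin n₁) (Fin n₂) ℝ)
    (μ : ℝ) (V₀ : Matrix (Fin n₁) (Fin k) ℝ) (W₀ : Matrix (Fin n₂) (Fin k) ℝ) (t : ℕ) :
    Matrix (Fin n₁ ⊕ Fin n₂) (Fin k) ℝ :=
  Zstack (iter A X μ V₀ W₀ t).1 (-(iter A X μ V₀ W₀ t).2)

/-- `Δ_t = (Id − ℬ*ℬ)(Z_tZ_tᵀ − Z̃_tZ̃_tᵀ − sym(X))`. -/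
def Δit (A : Fin m → Matrix (Fin n₁) (Fin n₂) ℝ) (X : Matrix (Fin n₁) (Fin n₂) ℝ)
    (μ : ℝ) (V₀ : Matrix (Fin n₁) (Fin k) ℝ) (W₀ : Matrix (Fin n₂) (Fin k) ℝ) (t : ℕ) :
    Matrix (Fin n₁ ⊕ Fin n₂) (Fin n₁ ⊕ Fin n₂) ℝ :=
  let D := Zit A X μ V₀ W₀ t * (Zit A X μ V₀ W₀ t)ᵀ
    - Ztil A X μ V₀ W₀ t * (Ztil A X μ V₀ W₀ t)ᵀ - symMat X
  D - BstarB A D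

/-- The block diagonal matrix `diag(Id_{n₁}, −Id_{n₂})`. -/
def flipSign (n₁ n₂ : ℕ) : Matrix (Fin n₁ ⊕ Fin n₂) (Fin n₁ ⊕ Fin n₂) ℝ :=
  Matrix.fromBlocks 1 0 0 (-1)

/-- Product Gaussian measure modelling the random initialization pair `(V, W)`
with i.i.d. standard Gaussian entries. -/
def gaussPair (n₁ n₂ k : ℕ) :
    Measure ((Fin n₁ → Fin k → ℝ) × (Fin n₂ → Fin k → ℝ)) :=
  (Measure.pi fun _ : Fin n₁ => Measure.pi fun _ : Fin k => gaussianReal 0 1).prod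
    (Measure.pi fun _ : Fin n₂ => Measure.pi fun _ : Fin k => gaussianReal 0 1)

open scoped Matrix.Norms.L2Operator in
theorem nrm_dot_le {a b : Type*} [Fintype a] [Fintype b] [DecidableEq b]
    (M : Matrix a b ℝ) (x : b → ℝ) :
    (M *ᵥ x) ⬝ᵥ (M *ᵥ x) ≤ ‖M‖ ^ 2 * (x ⬝ᵥ x) := by
  have h := Matrix.l2_opNorm_mulVec M (WithLp.toLp 2 x)
  have h2 := mul_self_le_mul_self (norm_nonneg _) h
  have e1 : ∀ {ι : Type _} [Fintype ι] (y : ι → ℝ), ‖WithLp.toLp 2 y‖ * ‖WithLp.toLp 2 y‖ = y ⬝ᵥ y := by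
    intro ι _ y
    rw [← sq, EuclideanSpace.real_norm_sq_eq]
    simp [dotProduct, sq]
  have e2 : ∀ {ι : Type _} [Fintype ι] (y : ι → ℝ), ‖WithLp.toLp 2 y‖ * ‖WithLp.toLp 2 y‖ = y ⬝ᵥ y := by
    intro ι _ y
    rw [← sq, EuclideanSpace.real_norm_sq_eq]
    simp [dotProduct, sq]
  have h3 := e1 (M *ᵥ x)
  have h4 := e2 x
  calc _ = _ := h3.symm
    _ ≤ _ := h2
    _ = ‖M‖ ^ 2 * (‖WithLp.toLp 2 x‖ * ‖WithLp.toLp 2 x‖) := by ring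
    _ = _ := by rw [h4]

theorem eucl_eq {a : Type*} [Fintype a] (y : a → ℝ) : euclNorm y = ‖WithLp.toLp 2 y‖ := by
  simp [euclNorm, EuclideanSpace.norm_eq]

open scoped Matrix.Norms.L2Operator in
theorem nrm_le {a b : Type*} [Fintype a] [Fintype b] [DecidableEq b]
    (M : Matrix a b ℝ) (C : ℝ) (hC : 0 ≤ C)
    (h : ∀ x : b → ℝ, (M *ᵥ x) ⬝ᵥ (M *ᵥ x) ≤ C ^ 2 * (x ⬝ᵥ x)) : ‖M‖ ≤ C := by
  rw [Matrix.l2_opNorm_def]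
  refine ContinuousLinearMap.opNorm_le_bound _ hC fun x => ?_
  have := h x.ofLp
  refine abs_le_of_sq_le_sq' ?_ (by positivity) |>.2
  rw [mul_pow, EuclideanSpace.real_norm_sq_eq, EuclideanSpace.real_norm_sq_eq]
  simpa [dotProduct, sq] using this

open scoped Matrix.Norms.L2Operator in
theorem spec_eq {a b : Type*} [Fintype a] [Fintype b] [DecidableEq b]
    (M : Matrix a b ℝ) : specNorm M = ‖M‖ := by
  have hb : ∀ x : b → ℝ, euclNorm x ≤ 1 → euclNorm (M.mulVec x) ≤ ‖M‖ := by
    intro x hx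
    rw [eucl_eq] at *
    have := Matrix.l2_opNorm_mulVec M (WithLp.toLp 2 x)
    refine this.trans ?_
    exact mul_le_of_le_one_right (norm_nonneg _) hx
  apply le_antisymm
  · apply Real.sSup_le _ (norm_nonneg _)
    rintro c ⟨x, hx, rfl⟩
    exact hb x hx
  · have bdd : BddAbove {c : ℝ | ∃ x : b → ℝ, euclNorm x ≤ 1 ∧ c = euclNorm (M.mulVec x)} := by
      refine ⟨‖M‖, ?_⟩
      rintro c ⟨x, hx, rfl⟩
      exact hb x hx
    have h0 : 0 ≤ specNorm M := by
      apply Real.sSup_nonneg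
      rintro c ⟨x, hx, rfl⟩
      exact Real.sqrt_nonneg _
    rw [Matrix.l2_opNorm_def]
    refine ContinuousLinearMap.opNorm_le_of_unit_norm h0 fun x hx => ?_
    apply le_csSup bdd
    refine ⟨x.ofLp, ?_, ?_⟩
    · rw [eucl_eq]; exact hx.le
    · rw [eucl_eq]; rfl

open scoped Matrix.Norms.L2Operator in
theorem nrm_T {a b : Type*} [Fintype a] [Fintype b] [DecidableEq a] [DecidableEq b]
    (M : Matrix a b ℝ) : ‖Mᵀ‖ = ‖M‖ := by
  rw [← Matrix.conjTranspose_eq_transpose_of_trivial, Matrix.l2_opNorm_conjTranspose]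

open scoped Matrix.Norms.L2Operator in
theorem nrm_TM {a b : Type*} [Fintype a] [Fintype b] [DecidableEq a] [DecidableEq b]
    (M : Matrix a b ℝ) : ‖Mᵀ * M‖ = ‖M‖ * ‖M‖ := by
  rw [← Matrix.conjTranspose_eq_transpose_of_trivial, Matrix.l2_opNorm_conjTranspose_mul_self]

open scoped Matrix.Norms.L2Operator in
theorem nrm_one {a : Type*} [Fintype a] [DecidableEq a] : ‖(1 : Matrix a a ℝ)‖ ≤ 1 := by
  refine nrm_le _ _ zero_le_one fun x => by simp

open scoped Matrix.Norms.L2Operator in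
theorem nrm_orth {a b : Type*} [Fintype a] [Fintype b] [DecidableEq a] [DecidableEq b]
    (M : Matrix a b ℝ) (h : Mᵀ * M = 1) : ‖M‖ ≤ 1 := by
  have := nrm_TM M
  rw [h] at this
  have h1 := nrm_one (a := b)
  nlinarith [norm_nonneg M]

open scoped Matrix.Norms.L2Operator in
/-- left multiplication with orthonormal columns -/
theorem nrm_orth_mul {a b c : Type*} [Fintype a] [Fintype b] [Fintype c] [DecidableEq a]
    [DecidableEq b] [DecidableEq c]
    (M : Matrix a b ℝ) (h : Mᵀ * M = 1) (V : Matrix b c ℝ) : ‖M * V‖ = ‖V‖ := by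
  have hM := nrm_orth M h
  apply le_antisymm
  · exact (Matrix.l2_opNorm_mul _ _).trans (mul_le_of_le_one_left (norm_nonneg _) hM)
  · have : V = Mᵀ * (M * V) := by rw [← Matrix.mul_assoc, h, Matrix.one_mul]
    calc ‖V‖ = ‖Mᵀ * (M * V)‖ := by rw [← this]
      _ ≤ ‖Mᵀ‖ * ‖M * V‖ := Matrix.l2_opNorm_mul _ _
      _ ≤ _ := mul_le_of_le_one_left (norm_nonneg _) (by rwa [nrm_T])

theorem complete_of_card {a b c : Type*} [Fintype a] [Fintype b] [Fintype c] [DecidableEq a]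
    [DecidableEq b] [DecidableEq c] (A : Matrix a b ℝ) (B : Matrix a c ℝ)
    (hA : Aᵀ * A = 1) (hB : Bᵀ * B = 1) (hAB : Aᵀ * B = 0)
    (hc : Fintype.card a = Fintype.card b + Fintype.card c) : A * Aᵀ + B * Bᵀ = 1 := by
  have hBA : Bᵀ * A = 0 := by
    have := congrArg Matrix.transpose hAB
    simpa using this
  have h1 : Matrix.fromRows Aᵀ Bᵀ * Matrix.fromCols A B = 1 := by
    rw [Matrix.fromRows_mul_fromCols, hA, hB, hAB, hBA, Matrix.fromBlocks_one]
  have h2 : Matrix.fromCols A B * Matrix.fromRows Aᵀ Bᵀ = 1 := by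
    refine (Matrix.mul_eq_one_comm_of_card_eq _ _ _ ?_).1 h1
    simp [hc]
  rwa [Matrix.fromCols_mul_fromRows] at h2

theorem card_le_of_orth {a b : Type*} [Fintype a] [Fintype b] [DecidableEq a]
    [DecidableEq b] (A : Matrix a b ℝ) 
    (hA : Aᵀ * A = 1) : Fintype.card b ≤ Fintype.card a := by
  have h : (Aᵀ * A).rank ≤ A.rank := Matrix.rank_mul_le_right _ _
  rw [hA, Matrix.rank_one] at h
  exact h.trans (Matrix.rank_le_card_height A)

theorem dot_cs {a : Type*} [Fintype a] (x y : a → ℝ) :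
    (x ⬝ᵥ y) ^ 2 ≤ (x ⬝ᵥ x) * (y ⬝ᵥ y) := by
  have := Finset.sum_mul_sq_le_sq_mul_sq Finset.univ x y
  simpa [dotProduct, sq] using this

open scoped Matrix.Norms.L2Operator in
theorem cubic_bound {a b : Type*} [Fintype a] [Fintype b] [DecidableEq a] [DecidableEq b]
    (Y : Matrix a b ℝ) (μ : ℝ) (hμ : 0 ≤ μ) (h : 4 * μ * ‖Y‖ ^ 2 ≤ 1) :
    ‖Y - μ • (Y * (Yᵀ * Y))‖ ≤ (1 - μ * ‖Y‖ ^ 2) * ‖Y‖ := by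
  set n := ‖Y‖ with hn
  have hn0 : 0 ≤ n := norm_nonneg _
  have hp : 0 ≤ μ * n ^ 2 := by positivity
  refine nrm_le _ _ (mul_nonneg (by linarith) hn0) fun x => ?_
  set y := Y *ᵥ x with hy
  set g := Yᵀ *ᵥ y with hg
  have e : (Y - μ • (Y * (Yᵀ * Y))) *ᵥ x = y - μ • (Y *ᵥ g) := by
    simp [Matrix.sub_mulVec, Matrix.smul_mulVec, ← Matrix.mulVec_mulVec, hy, hg]
  have e1 : y ⬝ᵥ (Y *ᵥ g) = g ⬝ᵥ g := by
    rw [Matrix.dotProduct_mulVec, ← Matrix.mulVec_transpose]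
  have e2 : y ⬝ᵥ y = x ⬝ᵥ g := by
    rw [hg, Matrix.dotProduct_mulVec x, ← Matrix.mulVec_transpose, Matrix.transpose_transpose]
  have b1 := nrm_dot_le Y g
  have b2 := nrm_dot_le Y x
  have b3 := dot_cs x g
  rw [← e2] at b3
  have G0 : 0 ≤ g ⬝ᵥ g := by simpa using dotProduct_star_self_nonneg g
  have x0 : 0 ≤ x ⬝ᵥ x := by simpa using dotProduct_star_self_nonneg x
  have y0 : 0 ≤ y ⬝ᵥ y := by simpa using dotProduct_star_self_nonneg y
  rw [e]
  have e3 : (y - μ • (Y *ᵥ g)) ⬝ᵥ (y - μ • (Y *ᵥ g))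
      = y ⬝ᵥ y - 2 * μ * (g ⬝ᵥ g) + μ ^ 2 * ((Y *ᵥ g) ⬝ᵥ (Y *ᵥ g)) := by
    simp only [sub_dotProduct, dotProduct_sub, smul_dotProduct, dotProduct_smul, e1,
      dotProduct_comm (Y *ᵥ g) y, smul_eq_mul]
    ring
  rw [e3]
  rw [← hn] at b1 b2
  rw [← hy] at b2
  generalize (Y *ᵥ g) ⬝ᵥ (Y *ᵥ g) = q at *
  generalize x ⬝ᵥ x = X at *
  generalize y ⬝ᵥ y = s at *
  generalize g ⬝ᵥ g = G at *
  have b1' : μ ^ 2 * q ≤ μ ^ 2 * (n ^ 2 * G) := by gcongr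
  rcases x0.eq_or_lt with hX | hX
  · subst hX
    have : s = 0 := by nlinarith
    subst this
    have h5 : μ * (μ * n ^ 2) * G ≤ μ * 2 * G := by
      gcongr; linarith
    nlinarith
  · set α := μ * (2 - μ * n ^ 2) with hα
    have hα0 : 0 ≤ α := mul_nonneg hμ (by linarith)
    have hα1 : α * (2 * n ^ 2) ≤ 1 := by
      have : α ≤ 2 * μ := by rw [hα]; nlinarith
      calc α * (2 * n ^ 2) ≤ 2 * μ * (2 * n ^ 2) := by gcongr
        _ ≤ 1 := by linarith
    have k1 : s - α * G ≤ n ^ 2 * X - α * n ^ 4 * X := by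
      refine le_of_mul_le_mul_right ?_ hX
      have k2 : 0 ≤ (n ^ 2 * X - s) * (X - α * (n ^ 2 * X + s)) := by
        refine mul_nonneg (by linarith) ?_
        have : α * (n ^ 2 * X + s) ≤ α * (2 * n ^ 2 * X) := by
          gcongr; linarith
        nlinarith
      have k3 := mul_le_mul_of_nonneg_left b3 hα0
      nlinarith
    have : ((1 - μ * n ^ 2) * n) ^ 2 * X = n ^ 2 * X - α * n ^ 4 * X := by rw [hα]; ring
    rw [this]
    have : s - 2 * μ * G + μ ^ 2 * (n ^ 2 * G) = s - α * G := by rw [hα]; ring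
    linarith

open scoped Matrix.Norms.L2Operator in
theorem contr_bound {a b : Type*} [Fintype a] [Fintype b] [DecidableEq a] [DecidableEq b]
    (F : Matrix a b ℝ) (μ : ℝ) (hμ : 0 ≤ μ) (h : μ * ‖F‖ ^ 2 ≤ 2) :
    ‖1 - μ • (F * Fᵀ)‖ ≤ 1 := by
  refine nrm_le _ _ zero_le_one fun y => ?_
  set g := Fᵀ *ᵥ y with hg
  have e : (1 - μ • (F * Fᵀ)) *ᵥ y = y - μ • (F *ᵥ g) := by
    simp [Matrix.sub_mulVec, Matrix.smul_mulVec, ← Matrix.mulVec_mulVec, hg]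
  have e1 : y ⬝ᵥ (F *ᵥ g) = g ⬝ᵥ g := by
    rw [Matrix.dotProduct_mulVec, ← Matrix.mulVec_transpose]
  have b1 := nrm_dot_le F g
  have G0 : 0 ≤ g ⬝ᵥ g := by simpa using dotProduct_star_self_nonneg g
  rw [e]
  have e3 : (y - μ • (F *ᵥ g)) ⬝ᵥ (y - μ • (F *ᵥ g))
      = y ⬝ᵥ y - 2 * μ * (g ⬝ᵥ g) + μ ^ 2 * ((F *ᵥ g) ⬝ᵥ (F *ᵥ g)) := by
    simp only [sub_dotProduct, dotProduct_sub, smul_dotProduct, dotProduct_smul, e1,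
      dotProduct_comm (F *ᵥ g) y, smul_eq_mul]
    ring
  rw [e3]
  have b1' : μ ^ 2 * ((F *ᵥ g) ⬝ᵥ (F *ᵥ g)) ≤ μ ^ 2 * (‖F‖ ^ 2 * (g ⬝ᵥ g)) := by gcongr
  have : μ * (μ * ‖F‖ ^ 2) * (g ⬝ᵥ g) ≤ μ * 2 * (g ⬝ᵥ g) := by gcongr
  nlinarith

open scoped Matrix.Norms.L2Operator in
theorem T_bound {ι ρ τ : Type*} [Fintype ι] [Fintype ρ] [Fintype τ]
    [DecidableEq ι] [DecidableEq ρ] [DecidableEq τ]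
    (L : Matrix ι ρ ℝ) (Lp : Matrix ι τ ℝ) (PZ : Matrix ι ρ ℝ) (M : Matrix ι ι ℝ)
    (V : Matrix ρ ρ ℝ) (δ η : ℝ)
    (hL : Lᵀ * L = 1) (hLp : Lpᵀ * Lp = 1) (hc : L * Lᵀ + Lp * Lpᵀ = 1) (hPZ : PZᵀ * PZ = 1)
    (hδ : ‖Lpᵀ * PZ‖ ≤ δ) (hη : ‖M‖ ≤ η) (hs : δ + η ≤ 1 / 2)
    (hV : Lᵀ * (PZ * V + M * PZ * V) = 1) :
    ‖Lpᵀ * (PZ * V + M * PZ * V)‖ ≤ 2 * (δ + η) := by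
  have nL : ‖Lᵀ‖ ≤ 1 := by rw [nrm_T]; exact nrm_orth L hL
  have nLp : ‖Lpᵀ‖ ≤ 1 := by rw [nrm_T]; exact nrm_orth Lp hLp
  have nP := nrm_orth PZ hPZ
  have hMPV : ‖M * PZ * V‖ ≤ η * ‖V‖ := by
    rw [Matrix.mul_assoc]
    refine (Matrix.l2_opNorm_mul _ _).trans ?_
    rw [nrm_orth_mul PZ hPZ]
    gcongr
  have hPV : ‖Lpᵀ * (PZ * V)‖ ≤ δ * ‖V‖ := by
    rw [← Matrix.mul_assoc]
    refine (Matrix.l2_opNorm_mul _ _).trans ?_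
    gcongr
  have m1 : ‖Lᵀ * (M * PZ * V)‖ ≤ η * ‖V‖ :=
    (Matrix.l2_opNorm_mul _ _).trans ((mul_le_of_le_one_left (norm_nonneg _) nL).trans hMPV)
  have m2 : ‖Lpᵀ * (M * PZ * V)‖ ≤ η * ‖V‖ :=
    (Matrix.l2_opNorm_mul _ _).trans ((mul_le_of_le_one_left (norm_nonneg _) nLp).trans hMPV)
  have m3 : ‖Lᵀ * (PZ * V)‖ ≤ 1 + η * ‖V‖ := by
    have : Lᵀ * (PZ * V) = 1 - Lᵀ * (M * PZ * V) := by rw [← hV, Matrix.mul_add]; abel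
    rw [this]
    exact (norm_sub_le _ _).trans (add_le_add nrm_one m1)
  have m4 : ‖V‖ ≤ (1 + η * ‖V‖) + δ * ‖V‖ := by
    calc ‖V‖ = ‖PZ * V‖ := (nrm_orth_mul PZ hPZ V).symm
      _ = ‖L * (Lᵀ * (PZ * V)) + Lp * (Lpᵀ * (PZ * V))‖ := by
        rw [← Matrix.mul_assoc L, ← Matrix.mul_assoc Lp, ← Matrix.add_mul, hc, Matrix.one_mul]
      _ ≤ ‖L * (Lᵀ * (PZ * V))‖ + ‖Lp * (Lpᵀ * (PZ * V))‖ := norm_add_le _ _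
      _ ≤ _ := by
        rw [nrm_orth_mul L hL, nrm_orth_mul Lp hLp]
        gcongr
  have m5 : ‖V‖ ≤ 2 := by nlinarith [norm_nonneg V]
  have s0 : 0 ≤ δ + η := add_nonneg ((norm_nonneg _).trans hδ) ((norm_nonneg _).trans hη)
  rw [Matrix.mul_add]
  refine (norm_add_le _ _).trans ?_
  nlinarith [norm_nonneg V]

set_option maxHeartbeats 2000000 in
open scoped Matrix.Norms.L2Operator in
theorem core {ι κ ρ τ ω : Type*} [Fintype ι] [Fintype κ] [Fintype ρ] [Fintype τ] [Fintype ω]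
    [DecidableEq ι] [DecidableEq κ] [DecidableEq ρ] [DecidableEq τ] [DecidableEq ω]
    (L : Matrix ι ρ ℝ) (Lp : Matrix ι τ ℝ) (PZ : Matrix ι ρ ℝ) (S Δ : Matrix ι ι ℝ)
    (F : Matrix τ ρ ℝ) (Z Zt Z1 : Matrix ι κ ℝ) (Qt : Matrix κ ρ ℝ) (Qtp Qsp : Matrix κ ω ℝ)
    (Sg : Matrix ρ ρ ℝ)
    (μ x δ : ℝ) (hμ : 0 ≤ μ) (hx : 0 ≤ x) (hδ0 : 0 ≤ δ) (hδ1 : δ ≤ 1 / 1000)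
    (hμx : μ * x ≤ δ)
    (hL : Lᵀ * L = 1) (hLp : Lpᵀ * Lp = 1) (hc : L * Lᵀ + Lp * Lpᵀ = 1)
    (hLLp : Lᵀ * Lp = 0)
    (hQtp : Qtpᵀ * Qtp = 1) (hQ : Qt * Qtᵀ + Qtp * Qtpᵀ = 1)
    (hQt : Qtᵀ * Qt = 1) (hQsp : Qspᵀ * Qsp = 1)
    (hZQ : Lᵀ * Z * Qtp = 0) (hZ1Q : Lᵀ * Z1 * Qsp = 0)
    (hP : PZᵀ * PZ = 1) (hPZ : PZ * PZᵀ * (Z * Qt) = Z * Qt)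
    (hU : IsUnit (Lᵀ * Z1 * Qt))
    (hLS : Lᵀ * S = Sg * Lᵀ) (hF : Lpᵀ * S * Lp = -(F * Fᵀ)) (hFx : ‖F‖ ^ 2 ≤ x)
    (hS : ‖S‖ ≤ 2 * x)
    (hZ1 : Z1 = Z + μ • ((S - Z * Zᵀ + Zt * Ztᵀ + Δ) * Z))
    (nZ : ‖Z‖ ≤ 2 * √x) (nZt : ‖Zt‖ ≤ 2 * √x) (nΔ : ‖Δ‖ ≤ δ * x)
    (nP : ‖Lpᵀ * PZ‖ ≤ δ) :
    ‖Z1 * Qsp‖ ≤ (1 - μ / 2 * ‖Z * Qtp‖ ^ 2 + μ * (1000 * δ * x)) * ‖Z * Qtp‖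
      + 2 * μ * √x * ‖Ztᵀ * Z * Qtp‖ := by
  set M := S - Z * Zᵀ + Zt * Ztᵀ + Δ with hM
  set U := Z * Qtp with hUdef
  set Y := Lpᵀ * U with hY
  set J := Lpᵀ * (Z * Qt) with hJ
  set s := √x with hs
  have s0 : 0 ≤ s := Real.sqrt_nonneg _
  have ss : s * s = x := Real.mul_self_sqrt hx
  have nL : ‖Lᵀ‖ ≤ 1 := by rw [nrm_T]; exact nrm_orth L hL
  have nLp : ‖Lpᵀ‖ ≤ 1 := by rw [nrm_T]; exact nrm_orth Lp hLp
  have nQtp := nrm_orth Qtp hQtp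
  have nQt := nrm_orth Qt hQt
  have nQsp := nrm_orth Qsp hQsp
  have LpL : Lpᵀ * L = 0 := by
    have := congrArg Matrix.transpose hLLp
    simpa using this
  have hLU : Lᵀ * U = 0 := by rw [hUdef, ← Matrix.mul_assoc, hZQ]
  have UY : U = Lp * Y := by
    have : U = (L * Lᵀ + Lp * Lpᵀ) * U := by rw [hc, Matrix.one_mul]
    rw [Matrix.add_mul, Matrix.mul_assoc L, hLU, Matrix.mul_zero, zero_add, Matrix.mul_assoc] at this
    exact this
  have nUY : ‖U‖ = ‖Y‖ := by rw [UY]; exact nrm_orth_mul Lp hLp Y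
  -- norm of M
  have zz : ∀ W : Matrix ι κ ℝ, ‖W‖ ≤ 2 * s → ‖W * Wᵀ‖ ≤ 4 * x := by
    intro W hW
    refine (Matrix.l2_opNorm_mul _ _).trans ?_
    rw [nrm_T]
    nlinarith [norm_nonneg W]
  have nM : ‖M‖ ≤ 11 * x := by
    have a1 := zz Z nZ
    have a2 := zz Zt nZt
    have a3 : ‖M‖ ≤ ‖S‖ + ‖Z * Zᵀ‖ + ‖Zt * Ztᵀ‖ + ‖Δ‖ := by
      rw [hM]
      refine (norm_add_le _ _).trans (add_le_add_left ?_ _)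
      refine (norm_add_le _ _).trans (add_le_add_left ?_ _)
      exact norm_sub_le _ _
    nlinarith
  -- T
  set K := Lᵀ * Z1 * Qt with hK
  have hKdet : IsUnit K.det := (Matrix.isUnit_iff_isUnit_det K).1 hU
  set V := PZᵀ * (Z * Qt) * K⁻¹ with hV
  set T := Lpᵀ * (PZ * V + (μ • M) * PZ * V) with hT
  have hPV : PZ * V = Z * Qt * K⁻¹ := by
    rw [hV, ← Matrix.mul_assoc, ← Matrix.mul_assoc, hPZ]
  have hPVM : PZ * V + (μ • M) * PZ * V = Z1 * Qt * K⁻¹ := by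
    rw [Matrix.mul_assoc, hPV, hZ1]
    simp only [Matrix.add_mul, Matrix.smul_mul, Matrix.mul_assoc]
  have nT : ‖T‖ ≤ 24 * δ := by
    have h := T_bound L Lp PZ (μ • M) V δ (11 * δ) hL hLp hc hP nP ?_ (by linarith) ?_
    · linarith
    · rw [norm_smul, Real.norm_of_nonneg hμ]
      nlinarith
    · rw [hPVM, ← Matrix.mul_assoc, ← Matrix.mul_assoc, ← hK]
      exact Matrix.mul_nonsing_inv K hKdet
  have hTK : T * K = Lpᵀ * Z1 * Qt := by
    rw [hT, hPVM, Matrix.mul_assoc, Matrix.mul_assoc (Z1 * Qt), Matrix.nonsing_inv_mul K hKdet,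
      Matrix.mul_one, Matrix.mul_assoc]
  -- H
  set H := Lpᵀ * Z1 - T * (Lᵀ * Z1) with hH
  have HQt : H * Qt = 0 := by
    rw [hH, Matrix.sub_mul, Matrix.mul_assoc T (Lᵀ * Z1) Qt, ← hK, hTK, sub_self]
  have HH : H = H * Qtp * Qtpᵀ := by
    have : H = H * (Qt * Qtᵀ + Qtp * Qtpᵀ) := by rw [hQ, Matrix.mul_one]
    rw [Matrix.mul_add, ← Matrix.mul_assoc, HQt, Matrix.zero_mul, zero_add, ← Matrix.mul_assoc]
      at this
    exact this
  have step1 : ‖Z1 * Qsp‖ ≤ ‖H * Qtp‖ := by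
    have e1 : H * Qsp = Lpᵀ * (Z1 * Qsp) := by
      rw [hH, Matrix.sub_mul, Matrix.mul_assoc T, hZ1Q, Matrix.mul_zero, sub_zero, Matrix.mul_assoc]
    have e2 : Z1 * Qsp = Lp * (H * Qsp) := by
      have : Z1 * Qsp = (L * Lᵀ + Lp * Lpᵀ) * (Z1 * Qsp) := by rw [hc, Matrix.one_mul]
      rw [Matrix.add_mul, Matrix.mul_assoc L, ← Matrix.mul_assoc Lᵀ, hZ1Q, Matrix.mul_zero,
        zero_add, Matrix.mul_assoc, ← e1] at this
      exact this
    rw [e2, nrm_orth_mul Lp hLp]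
    calc ‖H * Qsp‖ = ‖H * Qtp * Qtpᵀ * Qsp‖ := by rw [← HH]
      _ ≤ ‖H * Qtp * Qtpᵀ‖ * ‖Qsp‖ := Matrix.l2_opNorm_mul _ _
      _ ≤ ‖H * Qtp * Qtpᵀ‖ := mul_le_of_le_one_right (norm_nonneg _) nQsp
      _ ≤ ‖H * Qtp‖ * ‖Qtpᵀ‖ := Matrix.l2_opNorm_mul _ _
      _ ≤ _ := mul_le_of_le_one_right (norm_nonneg _) (by rwa [nrm_T])
  -- expansions
  have hZtU : Ztᵀ * Z * Qtp = Ztᵀ * U := by rw [Matrix.mul_assoc]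
  have hQZU : Qtᵀ * (Zᵀ * U) = Jᵀ * Y := by
    rw [hJ, UY]
    simp only [Matrix.transpose_mul, Matrix.transpose_transpose, Matrix.mul_assoc]
  have hQpZU : Qtpᵀ * (Zᵀ * U) = Yᵀ * Y := by
    have : Qtpᵀ * (Zᵀ * U) = Uᵀ * U := by
      rw [hUdef, Matrix.transpose_mul, Matrix.mul_assoc]
    rw [this]
    nth_rewrite 1 [UY]
    rw [Matrix.transpose_mul, Matrix.mul_assoc, ← hY]
  have hZZU : Z * (Zᵀ * U) = Z * Qt * (Jᵀ * Y) + U * (Yᵀ * Y) := by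
    rw [← hQZU, ← hQpZU, hUdef, Matrix.mul_assoc Z, Matrix.mul_assoc Z, ← Matrix.mul_add,
      ← Matrix.mul_assoc Qt, ← Matrix.mul_assoc Qtp, ← Matrix.add_mul, hQ, Matrix.one_mul]
  have hZ1Qtp : Z1 * Qtp = U + μ • (S * U - (Z * Qt * (Jᵀ * Y) + U * (Yᵀ * Y))
      + Zt * (Ztᵀ * U) + Δ * U) := by
    rw [← hZZU, hZ1, hM, Matrix.add_mul, Matrix.smul_mul, Matrix.mul_assoc _ Z, ← hUdef]
    simp only [Matrix.add_mul, Matrix.sub_mul, Matrix.mul_assoc]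
  have hSU : Lpᵀ * (S * U) = -(F * (Fᵀ * Y)) := by
    rw [UY, ← Matrix.mul_assoc S, ← Matrix.mul_assoc Lpᵀ, ← Matrix.mul_assoc Lpᵀ, hF,
      Matrix.neg_mul, Matrix.mul_assoc]
  have hLSU : Lᵀ * (S * U) = 0 := by
    rw [← Matrix.mul_assoc, hLS, Matrix.mul_assoc, hLU, Matrix.mul_zero]
  have E1 : Lpᵀ * (Z1 * Qtp) = ((1 - μ • (F * Fᵀ)) * (Y - μ • (Y * (Yᵀ * Y)))
      - (μ * μ) • (F * Fᵀ * (Y * (Yᵀ * Y))))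
      + μ • (Lpᵀ * (Zt * (Ztᵀ * U)) + (Lpᵀ * (Δ * U) - J * (Jᵀ * Y))) := by
    rw [hZ1Qtp]
    have q1 : Lpᵀ * (U * (Yᵀ * Y)) = Y * (Yᵀ * Y) := by rw [← Matrix.mul_assoc]
    have q2 : Lpᵀ * (Z * Qt * (Jᵀ * Y)) = J * (Jᵀ * Y) := by rw [← Matrix.mul_assoc]
    rw [Matrix.mul_assoc Z] at q2
    simp only [Matrix.mul_add, Matrix.mul_sub, Matrix.mul_smul, q1, q2, hSU, Matrix.sub_mul,
      Matrix.smul_mul, Matrix.one_mul, ← hY, smul_add, smul_sub, smul_smul, Matrix.mul_assoc,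
      smul_neg]
    abel
  have E2 : Lᵀ * (Z1 * Qtp) = μ • (Lᵀ * (Zt * (Ztᵀ * U)) + (Lᵀ * (Δ * U)
      - Lᵀ * (Z * Qt * (Jᵀ * Y)))) := by
    rw [hZ1Qtp]
    have q1 : Lᵀ * (U * (Yᵀ * Y)) = 0 := by rw [← Matrix.mul_assoc, hLU, Matrix.zero_mul]
    simp only [Matrix.mul_add, Matrix.mul_sub, Matrix.mul_smul, q1, hLSU, hLU]
    abel_nf
  have E3 : H * Qtp = Lpᵀ * (Z1 * Qtp) - T * (Lᵀ * (Z1 * Qtp)) := by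
    rw [hH, Matrix.sub_mul]
    simp only [Matrix.mul_assoc]
  -- norm estimates
  set n := ‖Y‖ with hn
  set N := ‖Ztᵀ * U‖ with hN
  have n0 : 0 ≤ n := norm_nonneg _
  have N0 : 0 ≤ N := norm_nonneg _
  have nn : n ≤ 2 * s := by
    rw [← nUY, hUdef]
    exact (Matrix.l2_opNorm_mul _ _).trans
      ((mul_le_of_le_one_right (norm_nonneg _) nQtp).trans nZ)
  have hNle : N ≤ 2 * s * n := by
    refine (Matrix.l2_opNorm_mul _ _).trans ?_
    rw [nrm_T, nUY]
    gcongr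
  have nZQt : ‖Z * Qt‖ ≤ 2 * s :=
    (Matrix.l2_opNorm_mul _ _).trans ((mul_le_of_le_one_right (norm_nonneg _) nQt).trans nZ)
  have nJ : ‖J‖ ≤ δ * (2 * s) := by
    have : J = (Lpᵀ * PZ) * (PZᵀ * (Z * Qt)) := by
      rw [hJ]
      nth_rewrite 1 [← hPZ]
      simp only [Matrix.mul_assoc]
    rw [this]
    refine (Matrix.l2_opNorm_mul _ _).trans ?_
    have : ‖PZᵀ * (Z * Qt)‖ ≤ 2 * s := by
      refine (Matrix.l2_opNorm_mul _ _).trans ?_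
      refine (mul_le_of_le_one_left (norm_nonneg _) ?_).trans nZQt
      rw [nrm_T]; exact nrm_orth PZ hP
    gcongr
  have nJY : ‖Jᵀ * Y‖ ≤ δ * (2 * s) * n := by
    refine (Matrix.l2_opNorm_mul _ _).trans ?_
    rw [nrm_T]
    gcongr
  have nJJY : ‖J * (Jᵀ * Y)‖ ≤ 4 * δ ^ 2 * x * n := by
    refine (Matrix.l2_opNorm_mul _ _).trans ?_
    calc ‖J‖ * ‖Jᵀ * Y‖ ≤ (δ * (2 * s)) * (δ * (2 * s) * n) := by gcongr
      _ = 4 * δ ^ 2 * (s * s) * n := by ring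
      _ = _ := by rw [ss]
  have nZJY : ‖Z * Qt * (Jᵀ * Y)‖ ≤ 4 * δ * x * n := by
    refine (Matrix.l2_opNorm_mul _ _).trans ?_
    calc ‖Z * Qt‖ * ‖Jᵀ * Y‖ ≤ (2 * s) * (δ * (2 * s) * n) := by gcongr
      _ = 4 * δ * (s * s) * n := by ring
      _ = _ := by rw [ss]
  have nΔU : ‖Δ * U‖ ≤ δ * x * n := by
    refine (Matrix.l2_opNorm_mul _ _).trans ?_
    rw [nUY]
    gcongr
  have nZtZtU : ‖Zt * (Ztᵀ * U)‖ ≤ 2 * s * N := by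
    refine (Matrix.l2_opNorm_mul _ _).trans ?_
    gcongr
  have Lle : ∀ B : Matrix ι ω ℝ, ‖Lᵀ * B‖ ≤ ‖B‖ := fun B =>
    (Matrix.l2_opNorm_mul _ _).trans (mul_le_of_le_one_left (norm_nonneg _) nL)
  have Lple : ∀ B : Matrix ι ω ℝ, ‖Lpᵀ * B‖ ≤ ‖B‖ := fun B =>
    (Matrix.l2_opNorm_mul _ _).trans (mul_le_of_le_one_left (norm_nonneg _) nLp)
  have n2 : n ^ 2 ≤ 4 * x := by nlinarith
  have μn : μ * n ^ 2 ≤ 4 * δ := by nlinarith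
  have G2 : ‖Lᵀ * (Z1 * Qtp)‖ ≤ 9 * μ * x * n := by
    rw [E2, norm_smul, Real.norm_of_nonneg hμ]
    have : ‖Lᵀ * (Zt * (Ztᵀ * U)) + (Lᵀ * (Δ * U) - Lᵀ * (Z * Qt * (Jᵀ * Y)))‖
        ≤ 2 * s * N + (δ * x * n + 4 * δ * x * n) :=
      (norm_add_le _ _).trans (add_le_add ((Lle _).trans nZtZtU)
        ((norm_sub_le _ _).trans (add_le_add ((Lle _).trans nΔU) ((Lle _).trans nZJY))))
    have h2 : 2 * s * N ≤ 4 * x * n := by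
      calc 2 * s * N ≤ 2 * s * (2 * s * n) := by gcongr
        _ = 4 * (s * s) * n := by ring
        _ = _ := by rw [ss]
    have h3 : δ * (x * n) ≤ 1 * (x * n) := by gcongr; linarith
    calc _ ≤ μ * (9 * x * n) := by
            gcongr
            refine this.trans ?_
            linarith
      _ = _ := by ring
  have G3 : ‖T * (Lᵀ * (Z1 * Qtp))‖ ≤ 216 * (μ * (δ * x) * n) := by
    refine (Matrix.l2_opNorm_mul _ _).trans ?_
    calc _ ≤ (24 * δ) * (9 * μ * x * n) := by gcongr
      _ = _ := by ring
  have nY3 : ‖Y * (Yᵀ * Y)‖ ≤ n ^ 3 := by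
    refine (Matrix.l2_opNorm_mul _ _).trans ?_
    rw [nrm_TM]
    apply le_of_eq; ring
  have nFF : ‖F * Fᵀ‖ ≤ x := by
    refine (Matrix.l2_opNorm_mul _ _).trans ?_
    rw [nrm_T, ← sq]; exact hFx
  have G4 : ‖(1 - μ • (F * Fᵀ)) * (Y - μ • (Y * (Yᵀ * Y)))
      - (μ * μ) • (F * Fᵀ * (Y * (Yᵀ * Y)))‖ ≤ (1 - μ * n ^ 2) * n + μ * δ * n ^ 3 := by
    refine (norm_sub_le _ _).trans (add_le_add ?_ ?_)
    · refine (Matrix.l2_opNorm_mul _ _).trans ?_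
      refine (mul_le_of_le_one_left (norm_nonneg _) (contr_bound F μ hμ ?_)).trans
        (cubic_bound Y μ hμ ?_)
      · have : μ * ‖F‖ ^ 2 ≤ μ * x := by gcongr
        linarith
      · rw [← hn]; linarith
    · rw [norm_smul, Real.norm_of_nonneg (mul_nonneg hμ hμ)]
      calc _ ≤ (μ * μ) * (x * n ^ 3) := by
            gcongr
            refine (Matrix.l2_opNorm_mul _ _).trans ?_
            gcongr
        _ = μ * (μ * x) * n ^ 3 := by ring
        _ ≤ _ := by gcongr
  have G5 : ‖μ • (Lpᵀ * (Zt * (Ztᵀ * U)) + (Lpᵀ * (Δ * U) - J * (Jᵀ * Y)))‖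
      ≤ μ * (2 * s * N + (δ * x * n + 4 * δ ^ 2 * x * n)) := by
    rw [norm_smul, Real.norm_of_nonneg hμ]
    gcongr
    exact (norm_add_le _ _).trans (add_le_add ((Lple _).trans nZtZtU)
        ((norm_sub_le _ _).trans (add_le_add ((Lple _).trans nΔU) nJJY)))
  rw [hZtU, nUY, ← hN]
  refine step1.trans ?_
  rw [E3, E1]
  refine (norm_sub_le _ _).trans ((add_le_add ((norm_add_le _ _).trans (add_le_add G4 G5)) G3).trans ?_)
  have w1 : δ * (μ * n ^ 3) ≤ 1 / 1000 * (μ * n ^ 3) := by gcongr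
  have w2 : δ * (μ * δ * x * n) ≤ 1 / 1000 * (μ * δ * x * n) := by gcongr
  have w3 : 0 ≤ μ * δ * x * n := by positivity
  have w4 : 0 ≤ μ * n ^ 3 := by positivity
  have w5 : (1 - μ / 2 * n ^ 2 + μ * (1000 * δ * x)) * n + 2 * μ * s * N
      - ((1 - μ * n ^ 2) * n + μ * δ * n ^ 3
        + μ * (2 * s * N + (δ * x * n + 4 * δ ^ 2 * x * n)) + 216 * (μ * (δ * x) * n))
      = 1 / 2 * (μ * n ^ 3) - δ * (μ * n ^ 3) + 783 * (μ * δ * x * n)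
        - 4 * (δ * (μ * δ * x * n)) := by ring
  linarith

theorem blocks_sub {a b c d : Type*} (A A' : Matrix a c ℝ) (B B' : Matrix a d ℝ)
    (C C' : Matrix b c ℝ) (D D' : Matrix b d ℝ) :
    Matrix.fromBlocks A B C D - Matrix.fromBlocks A' B' C' D'
      = Matrix.fromBlocks (A - A') (B - B') (C - C') (D - D') := by
  ext i j
  rcases i with i | i <;> rcases j with j | j <;> simp

theorem ZZ_eq {k : ℕ} (V : Matrix (Fin n₁) (Fin k) ℝ) (W : Matrix (Fin n₂) (Fin k) ℝ) :
    Zstack V W * (Zstack V W)ᵀ - Zstack V (-W) * (Zstack V (-W))ᵀ = symMat (V * Wᵀ) := by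
  have h2 : (√2)⁻¹ * (√2)⁻¹ = (1 / 2 : ℝ) := by
    rw [← mul_inv, Real.mul_self_sqrt (by norm_num)]; norm_num
  simp only [Zstack, symMat, Matrix.transpose_smul, Matrix.smul_mul, Matrix.mul_smul, smul_smul, h2,
    Matrix.transpose_fromRows, Matrix.fromRows_mul_fromCols]
  rw [← smul_sub, blocks_sub, Matrix.fromBlocks_smul]
  congr 1
  · simp
  · simp [← two_smul ℝ, smul_smul]
  · simp [← two_smul ℝ, smul_smul]
  · simp

theorem BB_sym (A : Fin m → Matrix (Fin n₁) (Fin n₂) ℝ) (M : Matrix (Fin n₁) (Fin n₂) ℝ) :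
    BstarB A (symMat M) = symMat (AstarA A M) := by
  have h2 : (√2)⁻¹ * (√2)⁻¹ = (1 / 2 : ℝ) := by
    rw [← mul_inv, Real.mul_self_sqrt (by norm_num)]; norm_num
  have hm : ∀ i, minner (Bmat A i) (symMat M) = (√2)⁻¹ * (2 * minner (A i) M) := by
    intro i
    simp only [minner, Bmat, symMat, Fintype.sum_sum_type, Matrix.smul_apply,
      Matrix.fromBlocks_apply₁₁, Matrix.fromBlocks_apply₁₂, Matrix.fromBlocks_apply₂₁,
      Matrix.fromBlocks_apply₂₂, Matrix.transpose_apply, Matrix.zero_apply, smul_eq_mul, mul_zero,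
      Finset.sum_const_zero, zero_add, add_zero]
    rw [Finset.sum_comm (s := (Finset.univ : Finset (Fin n₂)))]
    rw [two_mul, mul_add]
    simp only [Finset.mul_sum, mul_assoc]
  have hs : ∀ i, minner (Bmat A i) (symMat M) • Bmat A i = minner (A i) M • symMat (A i) := by
    intro i
    rw [hm, Bmat, smul_smul, symMat]
    congr 1
    calc (√2)⁻¹ * (2 * minner (A i) M) * (√2)⁻¹ = ((√2)⁻¹ * (√2)⁻¹) * 2 * minner (A i) M := by ring
      _ = _ := by rw [h2]; ring
  simp only [BstarB, hs, AstarA]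
  ext a b
  rcases a with a | a <;> rcases b with b | b <;>
    simp [symMat, Matrix.sum_apply]

theorem rec_eq {k : ℕ} (A : Fin m → Matrix (Fin n₁) (Fin n₂) ℝ) (X : Matrix (Fin n₁) (Fin n₂) ℝ)
    (μ : ℝ) (V₀ : Matrix (Fin n₁) (Fin k) ℝ) (W₀ : Matrix (Fin n₂) (Fin k) ℝ) (t : ℕ) :
    Zit A X μ V₀ W₀ (t + 1) = Zit A X μ V₀ W₀ t + μ • ((symMat X
      - Zit A X μ V₀ W₀ t * (Zit A X μ V₀ W₀ t)ᵀ + Ztil A X μ V₀ W₀ t * (Ztil A X μ V₀ W₀ t)ᵀ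
      + Δit A X μ V₀ W₀ t) * Zit A X μ V₀ W₀ t) := by
  have hD : symMat X
      - Zit A X μ V₀ W₀ t * (Zit A X μ V₀ W₀ t)ᵀ + Ztil A X μ V₀ W₀ t * (Ztil A X μ V₀ W₀ t)ᵀ
      + Δit A X μ V₀ W₀ t = - symMat (AstarA A
        ((iter A X μ V₀ W₀ t).1 * (iter A X μ V₀ W₀ t).2ᵀ - X)) := by
    rw [← BB_sym]
    have : Zit A X μ V₀ W₀ t * (Zit A X μ V₀ W₀ t)ᵀ
        - Ztil A X μ V₀ W₀ t * (Ztil A X μ V₀ W₀ t)ᵀ - symMat X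
        = symMat ((iter A X μ V₀ W₀ t).1 * (iter A X μ V₀ W₀ t).2ᵀ - X) := by
      rw [Zit, Ztil, ZZ_eq]
      simp only [symMat, blocks_sub, Matrix.transpose_sub, sub_zero]
    simp only [Δit]
    rw [← this]
    abel
  rw [hD]
  simp only [Zit, iter, Zstack]
  generalize AstarA A ((iter A X μ V₀ W₀ t).1 * (iter A X μ V₀ W₀ t).2ᵀ - X) = G
  rw [Matrix.mul_smul, smul_comm, ← smul_add, Matrix.neg_mul, symMat,
    Matrix.fromBlocks_mul_fromRows]
  congr 1
  ext a b
  rcases a with a | a <;> simp [sub_eq_add_neg]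

theorem til_eq {k : ℕ} (V : Matrix (Fin n₁) (Fin k) ℝ) (W : Matrix (Fin n₂) (Fin k) ℝ) :
    Zstack V (-W) = flipSign n₁ n₂ * Zstack V W := by
  simp only [Zstack, flipSign, Matrix.mul_smul, Matrix.fromBlocks_mul_fromRows]
  simp

theorem flip_orth : (flipSign n₁ n₂)ᵀ * flipSign n₁ n₂ = 1 := by
  simp [flipSign, Matrix.fromBlocks_transpose, Matrix.fromBlocks_multiply]

theorem stack_mul {r : ℕ} (P P' : Matrix (Fin n₁) (Fin r) ℝ) (Q Q' : Matrix (Fin n₂) (Fin r) ℝ) :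
    (Zstack P Q)ᵀ * Zstack P' Q' = (1 / 2 : ℝ) • (Pᵀ * P' + Qᵀ * Q') := by
  have h2 : (√2)⁻¹ * (√2)⁻¹ = (1 / 2 : ℝ) := by
    rw [← mul_inv, Real.mul_self_sqrt (by norm_num)]; norm_num
  simp only [Zstack, Matrix.transpose_smul, Matrix.smul_mul, Matrix.mul_smul, smul_smul, h2,
    Matrix.transpose_fromRows, Matrix.fromCols_mul_fromRows]

theorem sym_eq {r : ℕ} (P : Matrix (Fin n₁) (Fin r) ℝ) (Q : Matrix (Fin n₂) (Fin r) ℝ)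
    (d : Fin r → ℝ) :
    symMat (P * Matrix.diagonal d * Qᵀ) = Zstack P Q * Matrix.diagonal d * (Zstack P Q)ᵀ
      - Zstack P (-Q) * Matrix.diagonal d * (Zstack P (-Q))ᵀ := by
  have h2 : (√2)⁻¹ * (√2)⁻¹ = (1 / 2 : ℝ) := by
    rw [← mul_inv, Real.mul_self_sqrt (by norm_num)]; norm_num
  simp only [Zstack, symMat, Matrix.transpose_smul, Matrix.smul_mul, Matrix.mul_smul, smul_smul, h2,
    Matrix.transpose_fromRows, Matrix.fromRows_mul _ _ (Matrix.diagonal d),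
    Matrix.fromRows_mul_fromCols]
  rw [← smul_sub, blocks_sub, Matrix.fromBlocks_smul]
  congr 1
  · simp
  · simp [← two_smul ℝ, smul_smul]
  · simp [← two_smul ℝ, smul_smul, Matrix.mul_assoc]
  · simp

open scoped Matrix.Norms.L2Operator in
theorem sigma_le {a b : Type*} [Fintype a] [Fintype b] (M : Matrix a b ℝ) :
    0 ≤ sigmaPos M ∧ sigmaPos M ≤ specNorm M := by
  classical
  constructor
  · apply Real.sInf_nonneg
    rintro c ⟨x, hx, -, rfl⟩
    exact Real.sqrt_nonneg _
  · rw [sigmaPos]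
    rcases Set.eq_empty_or_nonempty {c : ℝ | ∃ x : b → ℝ, euclNorm x = 1 ∧
      (∀ y : b → ℝ, M.mulVec y = 0 → x ⬝ᵥ y = 0) ∧ c = euclNorm (M.mulVec x)} with h | h
    · rw [h, Real.sInf_empty, spec_eq]
      exact norm_nonneg _
    · obtain ⟨c, hc⟩ := h
      refine (csInf_le ⟨0, ?_⟩ hc).trans ?_
      · rintro c ⟨x, hx, -, rfl⟩
        exact Real.sqrt_nonneg _
      · obtain ⟨x, hx, -, rfl⟩ := hc
        rw [spec_eq, eucl_eq]
        rw [eucl_eq] at hx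
        have := Matrix.l2_opNorm_mulVec M (WithLp.toLp 2 x)
        rw [hx, mul_one] at this
        exact this

open scoped Matrix.Norms.L2Operator in
/-- control of the nuisance term `‖Z_tQ_{t,⊥}‖`. -/
theorem statement10_nuisance_growth :
    ∃ c : ℝ, 0 < c ∧
    ∀
    (n₁ n₂ m k r : ℕ)
    (A : Fin m → Matrix (Fin n₁) (Fin n₂) ℝ) (X : Matrix (Fin n₁) (Fin n₂) ℝ)
    (PX : Matrix (Fin n₁) (Fin r) ℝ) (QX : Matrix (Fin n₂) (Fin r) ℝ) (σX : Fin r → ℝ)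
    (hPX : PXᵀ * PX = 1) (hQX : QXᵀ * QX = 1)
    (hσpos : ∀ i, 0 < σX i) (hσanti : Antitone σX)
    (hXsvd : X = PX * Matrix.diagonal σX * QXᵀ)
    (μ : ℝ) (hμ : 0 < μ)
    (V₀ : Matrix (Fin n₁) (Fin k) ℝ) (W₀ : Matrix (Fin n₂) (Fin k) ℝ)
    (Z Z' : ℕ → Matrix (Fin n₁ ⊕ Fin n₂) (Fin k) ℝ)
    (hZ : Z = Zit A X μ V₀ W₀) (hZ' : Z' = Ztil A X μ V₀ W₀)
    (LX : Matrix (Fin n₁ ⊕ Fin n₂) (Fin r) ℝ) (hLX : LX = Zstack PX QX)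
    (κ σm : ℝ) (hκ : κ = condNum X) (hσm : σm = sigmaPos X)
    (Δ : ℕ → Matrix (Fin n₁ ⊕ Fin n₂) (Fin n₁ ⊕ Fin n₂) ℝ) (hΔ : Δ = Δit A X μ V₀ W₀)
    (LXp : Matrix (Fin n₁ ⊕ Fin n₂) (Fin (n₁ + n₂ - r)) ℝ)
    (hLXp1 : LXpᵀ * LXp = 1) (hLXp2 : LXᵀ * LXp = 0)
    (t : ℕ)
    (Qt : Matrix (Fin k) (Fin r) ℝ) (hQt1 : Qtᵀ * Qt = 1)
    (hQt2 : LXᵀ * Z t * Qt * Qtᵀ = LXᵀ * Z t)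
    (Qtp : Matrix (Fin k) (Fin (k - r)) ℝ) (hQtp1 : Qtpᵀ * Qtp = 1) (hQtp2 : Qtᵀ * Qtp = 0)
    (Qs : Matrix (Fin k) (Fin r) ℝ) (hQs1 : Qsᵀ * Qs = 1)
    (hQs2 : LXᵀ * Z (t + 1) * Qs * Qsᵀ = LXᵀ * Z (t + 1))
    (Qsp : Matrix (Fin k) (Fin (k - r)) ℝ) (hQsp1 : Qspᵀ * Qsp = 1) (hQsp2 : Qsᵀ * Qsp = 0)
    (PZ : Matrix (Fin n₁ ⊕ Fin n₂) (Fin r) ℝ) (hPZ : IsOrthCol PZ (Z t * Qt))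
    (ε : ℝ) (hε0 : 0 ≤ ε) (hε1 : ε ≤ 1)
    (h1 : μ ≤ c * ε / (specNorm X * κ))
    (h2 : specNorm (Z t) ≤ 2 * Real.sqrt (specNorm X))
    (h3 : specNorm (Δ t) ≤ c * ε * σm)
    (h4 : specNorm (LXpᵀ * PZ) ≤ c * ε / κ)
    (h5 : IsUnit (LXᵀ * Z (t + 1) * Qt))
    (h6 : IsUnit (LXᵀ * Z t * Qt)),
    specNorm (Z (t + 1) * Qsp)
      ≤ (1 - μ / 2 * specNorm (Z t * Qtp) ^ 2 + μ * ε * σm) * specNorm (Z t * Qtp)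
        + 2 * μ * Real.sqrt (specNorm X) * specNorm ((Z' t)ᵀ * Z t * Qtp) := by
  classical
  refine ⟨1 / 1000, by norm_num, ?_⟩
  intro n₁ n₂ m k r A X PX QX σX hPX hQX hσpos hσanti hXsvd μ hμ V₀ W₀ Z Z' hZ hZ' LX hLX κ σm hκ
    hσm Δ hΔ LXp hLXp1 hLXp2 t Qt hQt1 hQt2 Qtp hQtp1 hQtp2 Qs hQs1 hQs2 Qsp hQsp1 hQsp2 PZ hPZ
    ε hε0 hε1 h1 h2 h3 h4 h5 h6
  obtain ⟨hs0, hsx⟩ := sigma_le X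
  rw [← hσm] at hs0 hsx
  have hκ' : κ = specNorm X / σm := by rw [hκ, condNum, hσm]
  have hx0 : 0 ≤ specNorm X := hs0.trans hsx
  have hprod : specNorm X * κ ≠ 0 := by
    intro h
    rw [h, div_zero] at h1
    linarith
  have hx : 0 < specNorm X := lt_of_le_of_ne hx0 (Ne.symm (left_ne_zero_of_mul hprod))
  have hσ : 0 < σm := by
    refine lt_of_le_of_ne hs0 fun h => ?_
    rw [hκ', ← h, div_zero, mul_zero] at hprod
    exact hprod rfl
  set x := specNorm X with hxdef
  set δ := 1 / 1000 * ε / κ with hδ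
  have hδ' : δ = 1 / 1000 * ε * (σm / x) := by
    rw [hδ, hκ']; field_simp
  have hδx : δ * x = 1 / 1000 * ε * σm := by
    rw [hδ']; field_simp
  have hratio : σm / x ≤ 1 := (div_le_one hx).2 hsx
  have hratio0 : 0 ≤ σm / x := by positivity
  have hδ0 : 0 ≤ δ := by rw [hδ']; positivity
  have hδ1 : δ ≤ 1 / 1000 := by
    rw [hδ']
    have : ε * (σm / x) ≤ 1 := mul_le_one₀ hε1 hratio0 hratio
    linarith
  have hμx : μ * x ≤ δ := by
    have : 1 / 1000 * ε / (x * κ) = δ / x := by rw [hδ, div_div, mul_comm x κ]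
    rw [this, le_div_iff₀ hx] at h1
    exact h1
  have hL : LXᵀ * LX = 1 := by
    rw [hLX, stack_mul, hPX, hQX, ← two_smul ℝ, smul_smul]; norm_num
  have hcard := card_le_of_orth LX hL
  have hcardQ := card_le_of_orth Qt hQt1
  simp only [Fintype.card_fin, Fintype.card_sum] at hcard hcardQ
  have hc := complete_of_card LX LXp hL hLXp1 hLXp2 (by simp; omega)
  have hQ := complete_of_card Qt Qtp hQt1 hQtp1 hQtp2 (by simp; omega)
  set Lt := Zstack PX (-QX) with hLt
  set D := Matrix.diagonal σX with hD
  have hLLt : LXᵀ * Lt = 0 := by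
    rw [hLX, hLt, stack_mul, hPX, Matrix.mul_neg, hQX, add_neg_cancel, smul_zero]
  have hLtLt : Ltᵀ * Lt = 1 := by
    rw [hLt, stack_mul, hPX, Matrix.transpose_neg, Matrix.neg_mul, Matrix.mul_neg, neg_neg, hQX,
      ← two_smul ℝ, smul_smul]; norm_num
  have hsym : symMat X = LX * D * LXᵀ - Lt * D * Ltᵀ := by
    rw [hXsvd, sym_eq, ← hLX]
  have nD : ‖D‖ ≤ x := by
    have : D = PXᵀ * (X * QX) := by
      rw [hXsvd, Matrix.mul_assoc, hQX, Matrix.mul_one, ← Matrix.mul_assoc, hPX, Matrix.one_mul]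
    rw [this, hxdef, spec_eq]
    refine (Matrix.l2_opNorm_mul _ _).trans ?_
    rw [nrm_T]
    refine (mul_le_of_le_one_left (norm_nonneg _) (nrm_orth PX hPX)).trans ?_
    refine (Matrix.l2_opNorm_mul _ _).trans ?_
    exact mul_le_of_le_one_right (norm_nonneg _) (nrm_orth QX hQX)
  have conj : ∀ {a b : Type} [Fintype a] [Fintype b] [DecidableEq a] [DecidableEq b]
      (B : Matrix a b ℝ) (E : Matrix b b ℝ), ‖B‖ ≤ 1 → ‖B * E * Bᵀ‖ ≤ ‖E‖ := by
    intro a b _ _ _ _ B E hB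
    refine (Matrix.l2_opNorm_mul _ _).trans ?_
    rw [nrm_T]
    refine (mul_le_of_le_one_right (norm_nonneg _) hB).trans ?_
    refine (Matrix.l2_opNorm_mul _ _).trans ?_
    exact mul_le_of_le_one_left (norm_nonneg _) hB
  set F := LXpᵀ * Lt * Matrix.diagonal (fun i => √(σX i)) with hF
  have hDD : Matrix.diagonal (fun i => √(σX i)) * Matrix.diagonal (fun i => √(σX i)) = D := by
    rw [Matrix.diagonal_mul_diagonal, hD]
    congr 1
    funext i
    exact Real.mul_self_sqrt (hσpos i).le
  have hFF : F * Fᵀ = (LXpᵀ * Lt) * D * (LXpᵀ * Lt)ᵀ := by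
    rw [hF, ← hDD, Matrix.transpose_mul _ (Matrix.diagonal _), Matrix.diagonal_transpose]
    simp only [Matrix.mul_assoc]
  have nLt := nrm_orth Lt hLtLt
  have nLpLt : ‖LXpᵀ * Lt‖ ≤ 1 := by
    refine (Matrix.l2_opNorm_mul _ _).trans ?_
    rw [nrm_T]
    exact mul_le_one₀ (nrm_orth _ hLXp1) (norm_nonneg _) nLt
  have hFx : ‖F‖ ^ 2 ≤ x := by
    have := nrm_TM Fᵀ
    rw [Matrix.transpose_transpose, nrm_T, ← sq] at this
    rw [← this, hFF]
    exact (conj _ _ nLpLt).trans nD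
  have LpL : LXpᵀ * LX = 0 := by
    have := congrArg Matrix.transpose hLXp2
    simpa using this
  have hLS : LXᵀ * symMat X = D * LXᵀ := by
    rw [hsym, Matrix.mul_sub, ← Matrix.mul_assoc, ← Matrix.mul_assoc, hL, Matrix.one_mul,
      ← Matrix.mul_assoc, ← Matrix.mul_assoc, hLLt, Matrix.zero_mul, Matrix.zero_mul, sub_zero]
  have hFS : LXpᵀ * symMat X * LXp = -(F * Fᵀ) := by
    rw [hsym, hFF, Matrix.mul_sub, ← Matrix.mul_assoc, ← Matrix.mul_assoc, LpL, Matrix.zero_mul,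
      Matrix.zero_mul, zero_sub, Matrix.neg_mul, Matrix.transpose_mul, Matrix.transpose_transpose]
    simp only [Matrix.mul_assoc]
  have hS : ‖symMat X‖ ≤ 2 * x := by
    rw [hsym]
    refine (norm_sub_le _ _).trans ?_
    have a1 := (conj LX D (nrm_orth LX hL)).trans nD
    have a2 := (conj Lt D nLt).trans nD
    linarith
  have hZQ : LXᵀ * Z t * Qtp = 0 := by
    rw [← hQt2, Matrix.mul_assoc, hQtp2, Matrix.mul_zero]
  have hZ1Q : LXᵀ * Z (t + 1) * Qsp = 0 := by
    rw [← hQs2, Matrix.mul_assoc, hQsp2, Matrix.mul_zero]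
  obtain ⟨hP1, -, hP2⟩ := hPZ
  have hrec : Z (t + 1) = Z t + μ • ((symMat X - Z t * (Z t)ᵀ + Z' t * (Z' t)ᵀ + Δ t) * Z t) := by
    rw [hZ, hZ', hΔ]
    exact rec_eq A X μ V₀ W₀ t
  have hZZ' : ‖Z' t‖ = ‖Z t‖ := by
    rw [hZ, hZ', Ztil, til_eq, nrm_orth_mul _ flip_orth, Zit]
  rw [spec_eq] at h2 h3 h4
  have key := core LX LXp PZ (symMat X) (Δ t) F (Z t) (Z' t) (Z (t + 1)) Qt Qtp Qsp D μ x δ hμ.le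
    hx0 hδ0 hδ1 hμx hL hLXp1 hc hLXp2 hQtp1 hQ hQt1 hQsp1 hZQ hZ1Q hP1 hP2 h5 hLS hFS hFx hS hrec
    h2 (hZZ'.le.trans h2) (by rw [hδx]; exact h3) h4
  rw [spec_eq, spec_eq, spec_eq]
  have e : μ * (1000 * δ * x) = μ * ε * σm := by
    rw [mul_assoc 1000, hδx]; ring
  rw [e] at key
  exact key


end AsymMatrixSensing
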